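/- arXiv:2004.12063 — 2 statements merged into one kernel-verified Lean document; each statement's English description precedes it below -/
import Mathlib

section
/- If f : ℝ^d → ℝ^k is a deterministic polynomial of degree at most D, Y is a standard Gaussian random vector on ℝ^d, and q ∈ [2,∞), then E[‖f(Y)‖₂^{2q}] ≤ (3(q−1))^{qD} · (E[‖f(Y)‖₂²])^q. -/
open MeasureTheory ProbabilityTheory

noncomputable section
namespace HC

def T {V : Type*} [AddGroup V] (v : V) (F : V → ℝ) : V → ℝ :=
  fun x => (F (x + v) + F (x - v)) / 2

theorem choose_bound (m j : ℕ) : (2*m).choose (2*j) ≤ m.choose j * (2*m-1)^j := by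
  induction j with
  | zero => simp
  | succ j ih =>
    rcases Nat.lt_or_ge j m with h | h
    · obtain ⟨r, rfl⟩ := Nat.exists_eq_add_of_lt h
      have h1 := Nat.choose_succ_right_eq (2*(j+r+1)) (2*j)
      have h2 := Nat.choose_succ_right_eq (2*(j+r+1)) (2*j+1)
      have h3 := Nat.choose_succ_right_eq (j+r+1) j
      have e1 : 2*(j+r+1) - 2*j = 2*r+2 := by omega
      have e2 : 2*(j+r+1) - (2*j+1) = 2*r+1 := by omega
      have e3 : (j+r+1) - j = r+1 := by omega
      have e4 : 2*(j+r+1) - 1 = 2*j+2*r+1 := by omega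
      rw [e1] at h1; rw [e2] at h2; rw [e3] at h3; rw [e4] at ih ⊢
      have e5 : 2*(j+1) = 2*j+1+1 := by ring
      rw [e5]
      set a := (2*(j+r+1)).choose (2*j)
      set b := (2*(j+r+1)).choose (2*j+1)
      set c := (2*(j+r+1)).choose (2*j+1+1)
      set p := (j+r+1).choose j
      set s := (j+r+1).choose (j+1)
      set K := 2*j+2*r+1 with hK
      have hc : c * ((2*j+1)*(j+1)) = a * ((r+1)*(2*r+1)) := by
        have : 2 * (c * ((2*j+1)*(j+1))) = 2 * (a * ((r+1)*(2*r+1))) := by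
          calc 2 * (c * ((2*j+1)*(j+1))) = (c * (2*j+1+1)) * (2*j+1) := by ring
            _ = (b * (2*j+1)) * (2*r+1) := by rw [h2]; ring
            _ = _ := by rw [h1]; ring
        omega
      have hpos : 0 < (2*j+1)*(j+1) := by positivity
      refine Nat.le_of_mul_le_mul_right ?_ hpos
      rw [hc]
      calc a * ((r+1)*(2*r+1)) ≤ (p * K^j) * ((r+1)*(K*(2*j+1))) := by
            gcongr
            nlinarith [Nat.zero_le (j*j), Nat.zero_le (j*r)]
        _ = (p*(r+1)) * K^j * K * (2*j+1) := by ring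
        _ = (s*(j+1)) * K^j * K * (2*j+1) := by rw [h3]
        _ = _ := by ring
    · rw [Nat.choose_eq_zero_of_lt (by omega)]; simp

theorem sum_even (f : ℕ → ℝ) (hf : ∀ j, f (2*j+1) = 0) (m : ℕ) :
    ∑ i ∈ Finset.range (2*m+1), f i = ∑ j ∈ Finset.range (m+1), f (2*j) := by
  induction m with
  | zero => simp
  | succ m ih =>
    rw [show 2*(m+1)+1 = 2*m+1+1+1 by ring, Finset.sum_range_succ, Finset.sum_range_succ, ih,
      Finset.sum_range_succ _ (m+1), hf]
    simp; ring_nf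

theorem two_scalar (x y : ℝ) (m : ℕ) (hm : 1 ≤ m) :
    ((x+y)^(2*m) + (x-y)^(2*m))/2 ≤ (x^2 + (2*m-1)*y^2)^m := by
  have h1 : ((x+y)^(2*m) + (x-y)^(2*m))/2
      = ∑ i ∈ Finset.range (2*m+1), (y^i + (-y)^i)/2 * x^(2*m-i) * (2*m).choose i := by
    rw [add_comm x y, sub_eq_add_neg, add_comm x (-y), add_pow, add_pow, ← Finset.sum_add_distrib,
      Finset.sum_div]
    refine Finset.sum_congr rfl fun i _ => by ring
  rw [h1, sum_even]
  · rw [add_comm (x^2), add_pow]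
    refine Finset.sum_le_sum fun j hj => ?_
    have hc : ((2*m).choose (2*j) : ℝ) ≤ m.choose j * (2*m-1)^j := by
      have := choose_bound m j
      have h2 : ((2*m-1 : ℕ) : ℝ) = 2*m-1 := by
        rw [Nat.cast_sub (by omega)]; push_cast; ring
      rw [← h2]; exact_mod_cast this
    rw [show 2*m - 2*j = 2*(m-j) by omega]
    have h0 : 0 ≤ (y^2)^j * (x^2)^(m-j) := by positivity
    calc _ = ((y^2)^j * (x^2)^(m-j)) * ((2*m).choose (2*j) : ℝ) := by
            rw [pow_mul, pow_mul, pow_mul]; simp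
      _ ≤ ((y^2)^j * (x^2)^(m-j)) * (m.choose j * (2*m-1)^j) := by gcongr
      _ = _ := by rw [mul_pow]; ring
  · intro j; rw [Odd.neg_pow ⟨j, rfl⟩]; simp

theorem two_mono (s c e : ℝ) (hs : 0 ≤ s) (h : c^2 ≤ e^2) (m : ℕ) :
    (s+c)^m + (s-c)^m ≤ (s+e)^m + (s-e)^m := by
  have h1 : ∀ c : ℝ, (s+c)^m + (s-c)^m
      = ∑ i ∈ Finset.range (m+1), (c^i + (-c)^i) * s^(m-i) * m.choose i := by
    intro c
    rw [add_comm s c, sub_eq_add_neg, add_comm s (-c), add_pow, add_pow, ← Finset.sum_add_distrib]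
    refine Finset.sum_congr rfl fun i _ => by ring
  rw [h1, h1]
  refine Finset.sum_le_sum fun i _ => ?_
  gcongr ?_ * _ * _
  rcases Nat.even_or_odd' i with ⟨j, rfl | rfl⟩
  · have : (c^2)^j ≤ (e^2)^j := by gcongr
    simp only [pow_mul, neg_sq]; linarith
  · rw [Odd.neg_pow ⟨j, rfl⟩, Odd.neg_pow ⟨j, rfl⟩]; simp

theorem two_vec {k : ℕ} (A B : Fin k → ℝ) (m : ℕ) (hm : 1 ≤ m) :
    ((∑ i, (A i + B i)^2)^m + (∑ i, (A i - B i)^2)^m)/2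
      ≤ (∑ i, A i^2 + (2*m-1) * ∑ i, B i^2)^m := by
  have e1 : ∑ i, (A i + B i)^2 = (∑ i, A i^2 + ∑ i, B i^2) + 2 * ∑ i, A i * B i := by
    rw [Finset.mul_sum, ← Finset.sum_add_distrib, ← Finset.sum_add_distrib]
    exact Finset.sum_congr rfl fun i _ => by ring
  have e2 : ∑ i, (A i - B i)^2 = (∑ i, A i^2 + ∑ i, B i^2) - 2 * ∑ i, A i * B i := by
    rw [Finset.mul_sum, ← Finset.sum_add_distrib, ← Finset.sum_sub_distrib]
    exact Finset.sum_congr rfl fun i _ => by ring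
  have cs : (∑ i, A i * B i)^2 ≤ (∑ i, A i^2) * ∑ i, B i^2 := Finset.sum_mul_sq_le_sq_mul_sq _ _ _
  have ha : 0 ≤ ∑ i, A i^2 := by positivity
  have hb : 0 ≤ ∑ i, B i^2 := by positivity
  rw [e1, e2]
  generalize ∑ i, A i^2 = a at *
  generalize ∑ i, B i^2 = b at *
  generalize ∑ i, A i * B i = c at *
  have hx := Real.sq_sqrt ha
  have hy := Real.sq_sqrt hb
  have h1 := two_mono (a+b) (2*c) (2*(√a*√b)) (by positivity)
    (by rw [mul_pow, mul_pow, mul_pow, hx, hy]; linarith) m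
  have h2 := two_scalar (√a) (√b) m hm
  rw [pow_mul, pow_mul, add_sq, sub_sq, hx, hy] at h2
  have e3 : a + b + 2*(√a*√b) = a + 2*√a*√b + b := by ring
  have e4 : a + b - 2*(√a*√b) = a - 2*√a*√b + b := by ring
  rw [e3, e4] at h1
  linarith

/-! degree -/
def Deg {V : Type*} [AddCommGroup V] : ℕ → (V → ℝ) → Prop
  | 0, F => ∀ x y, F x = F y
  | D+1, F => ∀ v, Deg D (fun x => F (x + v) - F x)

section
variable {V : Type*} [AddCommGroup V]

theorem Deg.add {D : ℕ} : ∀ {F G : V → ℝ}, Deg D F → Deg D G → Deg D (fun x => F x + G x) := by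
  induction D with
  | zero => intro F G hF hG x y; simp only [hF x y, hG x y]
  | succ D ih =>
    intro F G hF hG v
    convert ih (hF v) (hG v) using 2
    ring

theorem Deg.smul {D : ℕ} (c : ℝ) : ∀ {F : V → ℝ}, Deg D F → Deg D (fun x => c * F x) := by
  induction D with
  | zero => intro F hF x y; simp only [hF x y]
  | succ D ih =>
    intro F hF v
    convert ih (hF v) using 2
    ring

theorem Deg.const {D : ℕ} : ∀ (c : ℝ), Deg D (fun _ : V => c) := by
  induction D with
  | zero => intro c x y; rfl
  | succ D ih => intro c v; simpa using ih 0

theorem Deg.shift {D : ℕ} (w : V) : ∀ {F : V → ℝ}, Deg D F → Deg D (fun x => F (x + w)) := by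
  induction D with
  | zero => intro F hF x y; exact hF _ _
  | succ D ih =>
    intro F hF v
    convert ih (hF v) using 4
    abel

theorem Deg.succ {D : ℕ} : ∀ {F : V → ℝ}, Deg D F → Deg (D+1) F := by
  induction D with
  | zero => intro F hF v x y; simp [hF (x+v) x, hF (y+v) y]
  | succ D ih => intro F hF v; exact ih (hF v)

theorem Deg.mono {D E : ℕ} (h : D ≤ E) {F : V → ℝ} (hF : Deg D F) : Deg E F := by
  induction h with
  | refl => exact hF
  | step _ ih => exact ih.succ

theorem Deg.mul (n : ℕ) : ∀ {a b : ℕ} {F G : V → ℝ}, a + b ≤ n → Deg a F → Deg b G →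
    Deg n (fun x => F x * G x) := by
  induction n with
  | zero =>
    intro a b F G h hF hG
    obtain rfl : a = 0 := by omega
    obtain rfl : b = 0 := by omega
    intro x y; simp only [hF x y, hG x y]
  | succ n ih =>
    intro a b F G h hF hG
    match a, b, h, hF, hG with
    | 0, b, h, hF, hG =>
      have : (fun x => F x * G x) = fun x => F 0 * G x := by funext x; rw [hF x 0]
      rw [this]; exact (hG.smul _).mono (by omega)
    | a+1, 0, h, hF, hG =>
      have : (fun x => F x * G x) = fun x => G 0 * F x := by funext x; rw [hG x 0, mul_comm]
      rw [this]; exact (hF.smul _).mono (by omega)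
    | a+1, b+1, h, hF, hG =>
      intro v
      convert (ih (a := a) (b := b+1) (by omega) (hF v) (hG.shift v)).add
        (ih (a := a+1) (b := b) (by omega) hF (hG v)) using 2
      ring

theorem Deg.sum {ι : Type*} (s : Finset ι) {D : ℕ} (F : ι → V → ℝ) (h : ∀ i ∈ s, Deg D (F i)) :
    Deg D (fun x => ∑ i ∈ s, F i x) := by
  classical
  induction s using Finset.induction_on with
  | empty => simpa using Deg.const 0
  | insert a s ha ih =>
    simp only [Finset.sum_insert ha]
    exact (h a (by simp)).add (ih fun i hi => h i (by simp [hi]))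

theorem Deg.prod {ι : Type*} (s : Finset ι) (e : ι → ℕ) (F : ι → V → ℝ)
    (h : ∀ i ∈ s, Deg (e i) (F i)) :
    Deg (∑ i ∈ s, e i) (fun x => ∏ i ∈ s, F i x) := by
  classical
  induction s using Finset.induction_on with
  | empty => simpa using Deg.const 1
  | insert a s ha ih =>
    simp only [Finset.prod_insert ha, Finset.sum_insert ha]
    exact Deg.mul _ le_rfl (h a (by simp)) (ih fun i hi => h i (by simp [hi]))

theorem Deg.pow {F : V → ℝ} (hF : Deg 1 F) (n : ℕ) : Deg n (fun x => F x ^ n) := by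
  induction n with
  | zero => simpa using Deg.const 1
  | succ n ih => simp only [pow_succ]; exact Deg.mul _ le_rfl ih hF
end

theorem deg_coord {d : ℕ} (i : Fin d) : Deg 1 (fun x : Fin d → ℝ => x i) := by
  intro v x y; simp

theorem deg_poly {d D : ℕ} (P : MvPolynomial (Fin d) ℝ) (h : P.totalDegree ≤ D) :
    Deg D (fun x => MvPolynomial.eval x P) := by
  simp only [MvPolynomial.eval_eq']
  refine Deg.sum _ _ fun s hs => Deg.smul _ ?_
  refine (Deg.prod Finset.univ (fun i => s i) _ fun i _ => (deg_coord i).pow _).mono ?_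
  refine le_trans ?_ h
  have := MvPolynomial.le_totalDegree hs
  rwa [Finsupp.sum_fintype _ _ (by simp)] at this

/-! walks -/
section
variable {V : Type*} [AddCommGroup V]

def W : List V → (V → ℝ) → V → ℝ
  | [], F => F
  | v :: vs, F => W vs (T v F)

theorem W_mono (vs : List V) : ∀ {F G : V → ℝ}, (∀ x, F x ≤ G x) → ∀ x, W vs F x ≤ W vs G x := by
  induction vs with
  | nil => intro F G h; exact h
  | cons v vs ih =>
    intro F G h
    refine ih fun x => ?_
    simp only [T]; linarith [h (x+v), h (x-v)]

theorem W_add (vs : List V) : ∀ (F G : V → ℝ) (x),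
    W vs (fun x => F x + G x) x = W vs F x + W vs G x := by
  induction vs with
  | nil => intro F G x; rfl
  | cons v vs ih =>
    intro F G x
    simp only [W]
    rw [← ih]; congr 1; funext y; simp only [T]; ring

theorem W_smul (vs : List V) : ∀ (c : ℝ) (F : V → ℝ) (x),
    W vs (fun x => c * F x) x = c * W vs F x := by
  induction vs with
  | nil => intro c F x; rfl
  | cons v vs ih =>
    intro c F x
    simp only [W]
    rw [← ih]; congr 1; funext y; simp only [T]; ring

theorem W_nonneg (vs : List V) : ∀ {F : V → ℝ}, (∀ x, 0 ≤ F x) → ∀ x, 0 ≤ W vs F x := by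
  induction vs with
  | nil => intro F h; exact h
  | cons v vs ih =>
    intro F h
    refine ih fun x => ?_
    simp only [T]; linarith [h (x+v), h (x-v)]

theorem W_sum {ι : Type*} (s : Finset ι) (vs : List V) (F : ι → V → ℝ) (x) :
    W vs (fun x => ∑ i ∈ s, F i x) x = ∑ i ∈ s, W vs (F i) x := by
  classical
  induction s using Finset.induction_on with
  | empty => simpa using W_smul vs 0 (fun _ => 0) x
  | insert a s ha ih => simp only [Finset.sum_insert ha, W_add, ih]

theorem W_append (vs ws : List V) : ∀ (F : V → ℝ), W (vs ++ ws) F = W ws (W vs F) := by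
  induction vs with
  | nil => intro F; rfl
  | cons v vs ih => intro F; exact ih _

theorem mink_pos (vs : List V) (x : V) (m : ℕ) {U U' : V → ℝ} (hU : ∀ x, 0 ≤ U x)
    (hU' : ∀ x, 0 ≤ U' x) {u u' : ℝ} (hu : 0 < u) (hu' : 0 < u')
    (h : W vs (fun x => U x ^ m) x ≤ u^m) (h' : W vs (fun x => U' x ^ m) x ≤ u'^m) :
    W vs (fun x => (U x + U' x)^m) x ≤ (u+u')^m := by
  have key : ∀ y, (U y + U' y)^m ≤
      ((u+u')^m * (u/(u+u')) / u^m) * U y^m + ((u+u')^m * (u'/(u+u')) / u'^m) * U' y^m := by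
    intro y
    have hc := (convexOn_pow (𝕜 := ℝ) m).2
      (Set.mem_Ici.2 (div_nonneg (hU y) hu.le)) (Set.mem_Ici.2 (div_nonneg (hU' y) hu'.le))
      (show 0 ≤ u/(u+u') by positivity) (show 0 ≤ u'/(u+u') by positivity) (by field_simp)
    simp only [smul_eq_mul] at hc
    have e : u/(u+u') * (U y/u) + u'/(u+u') * (U' y/u') = (U y + U' y)/(u+u') := by field_simp
    rw [e, div_pow, div_pow, div_pow, div_le_iff₀ (by positivity)] at hc
    refine hc.trans (le_of_eq ?_)
    ring
  refine (W_mono vs key x).trans ?_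
  rw [W_add, W_smul, W_smul]
  calc _ ≤ ((u+u')^m * (u/(u+u')) / u^m) * u^m + ((u+u')^m * (u'/(u+u')) / u'^m) * u'^m := by
        gcongr
    _ = (u+u')^m := by field_simp

theorem mink (vs : List V) (x : V) (m : ℕ) {U U' : V → ℝ} (hU : ∀ x, 0 ≤ U x)
    (hU' : ∀ x, 0 ≤ U' x) {u u' : ℝ} (hu : 0 ≤ u) (hu' : 0 ≤ u')
    (h : W vs (fun x => U x ^ m) x ≤ u^m) (h' : W vs (fun x => U' x ^ m) x ≤ u'^m) :
    W vs (fun x => (U x + U' x)^m) x ≤ (u+u')^m := by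
  have hc : Filter.Tendsto (fun e : ℝ => ((u+e)+(u'+e))^m) (nhdsWithin 0 (Set.Ioi 0))
      (nhds (((u+0)+(u'+0))^m)) :=
    (Continuous.tendsto (by fun_prop) 0).mono_left nhdsWithin_le_nhds
  simp only [add_zero] at hc
  refine ge_of_tendsto hc ?_
  filter_upwards [self_mem_nhdsWithin] with e he
  have he : 0 < e := he
  refine mink_pos vs x m hU hU' (by linarith) (by linarith) (h.trans ?_) (h'.trans ?_) <;>
  · gcongr; linarith

theorem hyper {k : ℕ} (m : ℕ) (hm : 1 ≤ m) (vs : List V) : ∀ (D : ℕ) (F : Fin k → V → ℝ),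
    (∀ i, Deg D (F i)) → ∀ x,
    W vs (fun x => (∑ i, F i x^2)^m) x ≤ ((2*m-1)^D * W vs (fun x => ∑ i, F i x^2) x)^m := by
  have hm1 : (1:ℝ) ≤ m := by exact_mod_cast hm
  have hK : (1:ℝ) ≤ 2*m-1 := by linarith
  induction vs with
  | nil =>
    intro D F _ x
    simp only [W]
    have : (1:ℝ) ≤ (2*m-1)^D := one_le_pow₀ hK
    have h0 : 0 ≤ ∑ i, F i x^2 := by positivity
    gcongr
    nlinarith
  | cons v vs ih =>
    intro D F hF x
    let A : Fin k → V → ℝ := fun i y => (F i (y+v) + F i (y-v))/2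
    let B : Fin k → V → ℝ := fun i y => (F i (y+v) - F i (y-v))/2
    have hA : ∀ i, Deg D (A i) := by
      intro i
      convert (((hF i).shift v).add ((hF i).shift (-v))).smul (1/2) using 2
      simp only [A, sub_eq_add_neg]; ring
    have e2 : T v (fun x => ∑ i, F i x^2) = fun y => ∑ i, A i y^2 + ∑ i, B i y^2 := by
      funext y
      simp only [T, A, B]
      rw [← Finset.sum_add_distrib, ← Finset.sum_add_distrib, Finset.sum_div]
      exact Finset.sum_congr rfl fun i _ => by ring
    have e1 : ∀ y, T v (fun x => (∑ i, F i x^2)^m) y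
        ≤ (∑ i, A i y^2 + (2*m-1) * ∑ i, B i y^2)^m := by
      intro y
      refine le_trans (le_of_eq ?_) (two_vec (fun i => A i y) (fun i => B i y) m hm)
      simp only [T, A, B]
      congr 4 <;> (funext i; ring)
    simp only [W]
    refine (W_mono vs e1 x).trans ?_
    rw [e2, W_add, mul_add]
    have nA : 0 ≤ W vs (fun x => ∑ i, A i x^2) x := W_nonneg vs (fun y => by positivity) x
    have nB : 0 ≤ W vs (fun x => ∑ i, B i x^2) x := W_nonneg vs (fun y => by positivity) x
    have hK0 : (0:ℝ) ≤ 2*m-1 := by linarith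
    refine mink vs x m (U := fun y => ∑ i, A i y^2) (U' := fun y => (2*m-1) * ∑ i, B i y^2)
      (fun y => by positivity) (fun y => by positivity) (by positivity)
      (by positivity) (ih D A hA x) ?_
    simp only [mul_pow]
    rw [W_smul]
    cases D with
    | zero =>
      have hB : ∀ i y, B i y = 0 := by
        intro i y; simp only [B]; rw [hF i (y+v) (y-v)]; simp
      have hz : W vs (fun _ => (0:ℝ)) x = 0 := by simpa using W_smul vs 0 (fun _ => 0) x
      have : m ≠ 0 := by omega
      simp [hB, hz, this]
    | succ D =>
      have hB : ∀ i, Deg D (B i) := by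
        intro i
        have := ((hF i (v+v)).shift (-v)).smul (1/2)
        convert this using 2
        simp only [B]
        rw [show ∀ y : V, y + -v + (v+v) = y + v from fun y => by abel, sub_eq_add_neg _ v]; ring
      have := ih D B hB x
      calc _ ≤ (2*m-1)^m * ((2*m-1)^D * W vs (fun x => ∑ i, B i x^2) x)^m := by gcongr
        _ = _ := by simp only [mul_pow, pow_succ]; ring
end

/-! Gaussian moments -/
def M (k : ℕ) : ℝ := ∫ x, x^k ∂(gaussianReal 0 1)

theorem integrable_pow (k : ℕ) : Integrable (fun x : ℝ => x^k) (gaussianReal 0 1) :=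
  integrable_pow_of_mem_interior_integrableExpSet (X := fun x : ℝ => x) (by simp) k

theorem M_zero : M 0 = 1 := by simp [M]

theorem M_succ (k : ℕ) : M (k+1) = k * M (k-1) := by
  have hd : ∀ x, HasDerivAt (gaussianPDFReal 0 1) (-x * gaussianPDFReal 0 1 x) x := by
    intro x
    unfold gaussianPDFReal
    have h1 : HasDerivAt (fun x : ℝ => -(x-0)^2 / (2 * ((1:NNReal):ℝ))) (-x) x := by
      have := (((hasDerivAt_id x).sub_const 0).pow 2).neg.div_const (2 * ((1:NNReal):ℝ))
      refine HasDerivAt.congr_deriv this ?_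
      simp; try ring
    refine HasDerivAt.congr_deriv (h1.exp.const_mul ((√(2 * Real.pi * ((1:NNReal):ℝ)))⁻¹)) ?_
    ring
  have hi : ∀ j : ℕ, Integrable (fun x : ℝ => x^j * gaussianPDFReal 0 1 x) := by
    intro j
    have := integrable_pow j
    rw [gaussianReal_of_var_ne_zero _ (by simp)] at this
    rw [integrable_withDensity_iff (measurable_gaussianPDF 0 1)
      (Filter.Eventually.of_forall fun x => by simp [gaussianPDF])] at this
    simpa [toReal_gaussianPDF] using this
  have hM : ∀ j, M j = ∫ x, x^j * gaussianPDFReal 0 1 x := by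
    intro j
    rw [M, integral_gaussianReal_eq_integral_smul (by simp)]
    simp only [smul_eq_mul, mul_comm]
  have := integral_mul_deriv_eq_deriv_mul_of_integrable (u := fun x : ℝ => x^k)
    (v := gaussianPDFReal 0 1) (u' := fun x : ℝ => k * x^(k-1))
    (v' := fun x => -x * gaussianPDFReal 0 1 x)
    (fun x _ => hasDerivAt_pow k x) (fun x _ => hd x)
    ((hi (k+1)).neg.congr (Filter.Eventually.of_forall fun x => by simp; ring))
    (((hi (k-1)).const_mul (k:ℝ)).congr (Filter.Eventually.of_forall fun x => by simp; ring))
    (hi k)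
  rw [hM, hM, ← integral_const_mul]
  have e1 : ∫ x, x^(k+1) * gaussianPDFReal 0 1 x = - ∫ x, x^k * (-x * gaussianPDFReal 0 1 x) := by
    rw [← integral_neg]; congr 1; funext x; ring
  rw [e1, this, neg_neg]; congr 1; funext x; ring

def dd (h : ℝ) (F : ℝ → ℝ) : ℝ → ℝ := fun x => (F (x + h) - F (x - h))/2

theorem W_comm (h : ℝ) (n : ℕ) : ∀ (F : ℝ → ℝ) (x : ℝ),
    W (List.replicate (n+1) h) (fun x => x * F x) x
      = x * W (List.replicate (n+1) h) F x + (n+1) * h * W (List.replicate n h) (dd h F) x := by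
  induction n with
  | zero => intro F x; simp [W, T, dd]; ring
  | succ n ih =>
    intro F x
    have e : T h (fun x => x * F x) = fun x => x * T h F x + h * dd h F x := by
      funext y; simp only [T, dd]; ring
    have e' : dd h (T h F) = T h (dd h F) := by
      funext y; simp only [T, dd]
      rw [show y + h - h = y - h + h by ring]; ring
    rw [List.replicate_succ]
    simp only [W]
    rw [e, W_add, W_smul, ih, e']
    simp only [List.replicate_succ, W]
    push_cast; ring

theorem W_one (vs : List ℝ) (x : ℝ) : W vs (fun _ => 1) x = 1 := by
  induction vs with
  | nil => rfl
  | cons v vs ih => 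
    have e : T v (fun _ : ℝ => (1:ℝ)) = fun _ => 1 := by funext y; simp [T]
    rw [W, e, ih]

def hh (N : ℕ) : ℝ := (√(N:ℝ))⁻¹

theorem hh_tendsto : Filter.Tendsto hh Filter.atTop (nhds 0) :=
  tendsto_inv_atTop_zero.comp (Real.tendsto_sqrt_atTop.comp tendsto_natCast_atTop_atTop)

theorem hh_sq (N : ℕ) : hh N ^2 = (N:ℝ)⁻¹ := by
  rw [hh, inv_pow, Real.sq_sqrt (by positivity)]

theorem coef_tendsto (c j : ℕ) : Filter.Tendsto
    (fun N : ℕ => ((N:ℝ) - c) * hh N * ((hh N^j - (-hh N)^j)/2)) Filter.atTop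
    (nhds (if j = 1 then 1 else 0)) := by
  have h2 : Filter.Tendsto (fun N : ℕ => ((N:ℝ) - c) * hh N^2) Filter.atTop (nhds 1) := by
    have : Filter.Tendsto (fun N : ℕ => 1 - (c:ℝ) * hh N^2) Filter.atTop
        (nhds (1 - (c:ℝ) * 0^2)) := tendsto_const_nhds.sub ((hh_tendsto.pow 2).const_mul _)
    simp only [ne_eq, OfNat.ofNat_ne_zero, not_false_eq_true, zero_pow, mul_zero, sub_zero] at this
    refine this.congr' ?_
    filter_upwards [Filter.eventually_gt_atTop 0] with N hN
    have : (N:ℝ) ≠ 0 := by positivity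
    rw [hh_sq, sub_mul, mul_inv_cancel₀ this]
  cases j with
  | zero => simp
  | succ j =>
    have h3 := (h2.mul (hh_tendsto.pow j)).mul_const ((1 - (-1:ℝ)^(j+1))/2)
    convert h3 using 1
    · funext N; rw [neg_pow (hh N)]; ring
    · cases j <;> simp

theorem mom_tendsto (k : ℕ) : ∀ c : ℕ, Filter.Tendsto
    (fun N : ℕ => W (List.replicate (N-c) (hh N)) (fun x => x^k) 0) Filter.atTop (nhds (M k)) := by
  induction k using Nat.strong_induction_on with
  | _ k ih =>
  intro c
  cases k with
  | zero => simp [W_one, M_zero]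
  | succ k =>
    have h1 : Filter.Tendsto (fun N : ℕ => ∑ j ∈ Finset.range (k+1),
        (((N:ℝ) - c) * hh N * ((hh N^j - (-hh N)^j)/2)) * (k.choose j : ℝ) *
          W (List.replicate (N-(c+1)) (hh N)) (fun x => x^(k-j)) 0) Filter.atTop
        (nhds (∑ j ∈ Finset.range (k+1), (if j = 1 then 1 else 0) * (k.choose j : ℝ) * M (k-j))) :=
      tendsto_finsetSum _ fun j hj =>
        ((coef_tendsto c j).mul_const _).mul (ih (k-j) (by omega) (c+1))
    have h2 : ∑ j ∈ Finset.range (k+1), (if j = 1 then (1:ℝ) else 0) * (k.choose j : ℝ) * M (k-j)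
        = M (k+1) := by
      rw [M_succ]
      simp only [ite_mul, one_mul, zero_mul, Finset.sum_ite_eq']
      cases k <;> simp
    rw [h2] at h1
    refine h1.congr' ?_
    filter_upwards [Filter.eventually_ge_atTop (c+1)] with N hN
    obtain ⟨n, rfl⟩ := Nat.exists_eq_add_of_le hN
    rw [show c + 1 + n - c = n + 1 by omega, show c+1+n-(c+1) = n by omega]
    simp only [pow_succ']
    rw [W_comm]
    have e : dd (hh (c+1+n)) (fun x => x^k) = fun x => ∑ j ∈ Finset.range (k+1),
        (((hh (c+1+n))^j - (-hh (c+1+n))^j)/2 * (k.choose j : ℝ)) * x^(k-j) := by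
      funext x
      simp only [dd]
      rw [add_comm x, sub_eq_add_neg x, add_comm x, add_pow, add_pow, ← Finset.sum_sub_distrib,
        Finset.sum_div]
      exact Finset.sum_congr rfl fun j _ => by ring
    rw [e, W_sum, zero_mul, zero_add, Finset.mul_sum]
    refine Finset.sum_congr rfl fun j _ => ?_
    rw [W_smul]; push_cast; ring

/-! product -/
def prodF {d : ℕ} (φ : Fin d → ℝ → ℝ) : (Fin d → ℝ) → ℝ := fun x => ∏ i, φ i (x i)

theorem T_prodF {d : ℕ} (φ : Fin d → ℝ → ℝ) (i : Fin d) (h : ℝ) :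
    T (Pi.single i h) (prodF φ) = prodF (Function.update φ i (T h (φ i))) := by
  funext x
  simp only [T, prodF]
  rw [← Finset.mul_prod_erase _ _ (Finset.mem_univ i), ← Finset.mul_prod_erase _ _ (Finset.mem_univ i),
    ← Finset.mul_prod_erase Finset.univ (fun j => Function.update φ i _ j (x j)) (Finset.mem_univ i)]
  have h1 : ∏ j ∈ Finset.univ.erase i, φ j ((x + Pi.single i h : Fin d → ℝ) j)
      = ∏ j ∈ Finset.univ.erase i, φ j (x j) :=
    Finset.prod_congr rfl fun j hj => by simp [Finset.ne_of_mem_erase hj]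
  have h2 : ∏ j ∈ Finset.univ.erase i, φ j ((x - Pi.single i h : Fin d → ℝ) j)
      = ∏ j ∈ Finset.univ.erase i, φ j (x j) :=
    Finset.prod_congr rfl fun j hj => by simp [Finset.ne_of_mem_erase hj]
  have h3 : ∏ j ∈ Finset.univ.erase i, Function.update φ i (T h (φ i)) j (x j)
      = ∏ j ∈ Finset.univ.erase i, φ j (x j) :=
    Finset.prod_congr rfl fun j hj => by simp [Finset.ne_of_mem_erase hj]
  rw [h1, h2, h3]
  simp [T]; ring

theorem W_rep_prodF {d : ℕ} (i : Fin d) (h : ℝ) (n : ℕ) : ∀ (φ : Fin d → ℝ → ℝ),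
    W (List.replicate n (Pi.single i h)) (prodF φ)
      = prodF (Function.update φ i (W (List.replicate n h) (φ i))) := by
  induction n with
  | zero => intro φ; simp [W]
  | succ n ih => intro φ; simp only [List.replicate_succ, W]; rw [T_prodF, ih]; simp

def walk (d n : ℕ) (h : ℝ) (l : List (Fin d)) : List (Fin d → ℝ) :=
  l.flatMap fun i => List.replicate n (Pi.single i h)

theorem W_walk {d : ℕ} (h : ℝ) (n : ℕ) (l : List (Fin d)) : l.Nodup → ∀ (φ : Fin d → ℝ → ℝ),
    W (walk d n h l) (prodF φ)
      = prodF (fun j => if j ∈ l then W (List.replicate n h) (φ j) else φ j) := by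
  induction l with
  | nil => intro _ φ; simp [walk, W]
  | cons i l ih =>
    intro hl φ
    have hn := List.nodup_cons.1 hl
    have : walk d n h (i :: l) = List.replicate n (Pi.single i h) ++ walk d n h l := by
      simp [walk]
    rw [this, W_append, W_rep_prodF, ih hn.2]
    congr 1; funext j
    by_cases hj : j = i
    · subst hj; simp [hn.1]
    · simp [hj]

theorem integrable_poly {d : ℕ} (P : MvPolynomial (Fin d) ℝ) :
    Integrable (fun x => MvPolynomial.eval x P) (Measure.pi fun _ : Fin d => gaussianReal 0 1) := by
  simp only [MvPolynomial.eval_eq']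
  refine integrable_finsetSum _ fun s _ => Integrable.const_mul ?_ _
  exact Integrable.fintype_prod (f := fun i x => x ^ s i) fun i => integrable_pow _

theorem poly_tendsto {d : ℕ} (P : MvPolynomial (Fin d) ℝ) : Filter.Tendsto
    (fun N : ℕ => W (walk d N (hh N) (List.finRange d)) (fun x => MvPolynomial.eval x P) 0)
    Filter.atTop (nhds (∫ x, MvPolynomial.eval x P ∂(Measure.pi fun _ : Fin d => gaussianReal 0 1))) := by
  simp only [MvPolynomial.eval_eq']
  rw [integral_finsetSum _ fun s _ => Integrable.const_mul
    (Integrable.fintype_prod (f := fun i x => x ^ s i) fun i => integrable_pow _) _]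
  simp only [W_sum]
  refine tendsto_finsetSum _ fun s _ => ?_
  simp only [W_smul]
  rw [integral_const_mul]
  refine Filter.Tendsto.const_mul _ ?_
  rw [integral_fintype_prod_eq_prod (fun i x => x ^ s i)]
  have : ∀ N : ℕ, W (walk d N (hh N) (List.finRange d)) (fun x => ∏ i, x i ^ s i) 0
      = ∏ i, W (List.replicate N (hh N)) (fun x => x ^ s i) 0 := by
    intro N
    have := congrFun (W_walk (hh N) N (List.finRange d) (List.nodup_finRange d)
      (fun i x => x ^ s i)) 0
    simp only [List.mem_finRange, if_true] at this
    exact this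
  simp only [this]
  exact tendsto_finsetProd _ fun i _ => mom_tendsto (s i) 0

theorem gauss_hyper {d k D : ℕ} (P : Fin k → MvPolynomial (Fin d) ℝ)
    (hdeg : ∀ i, (P i).totalDegree ≤ D) (m : ℕ) (hm : 1 ≤ m) :
    (∫ y, (∑ i, MvPolynomial.eval y (P i)^2)^m ∂(Measure.pi fun _ : Fin d => gaussianReal 0 1))
      ≤ ((2*m-1)^D * ∫ y, ∑ i, MvPolynomial.eval y (P i)^2
          ∂(Measure.pi fun _ : Fin d => gaussianReal 0 1))^m := by
  have h1 := poly_tendsto ((∑ i, P i^2)^m)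
  have h2 := poly_tendsto (∑ i, P i^2)
  simp only [map_pow, map_sum] at h1 h2
  exact le_of_tendsto_of_tendsto' h1 ((h2.const_mul _).pow m) fun N =>
    hyper m hm _ D (fun i x => MvPolynomial.eval x (P i)) (fun i => deg_poly _ (hdeg i)) 0

theorem scal (m : ℕ) (hm : 2 ≤ m) (t : ℝ) (h0 : 0 ≤ t) (h1 : t ≤ 1) :
    ((2*m-1:ℝ)^m)^(1-t) * ((2*(m+1:ℕ)-1:ℝ)^(m+1))^t ≤ (3*((m+t)-1))^((m:ℝ)+t) := by
  have hm' : (2:ℝ) ≤ m := by exact_mod_cast hm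
  have ht : 0 ≤ 1 - t := by linarith
  set q : ℝ := m + t with hq
  have hqp : 0 < q := by linarith
  have p1 : (0:ℝ) ≤ 2*m-1 := by linarith
  have p2 : (0:ℝ) ≤ 2*(m+1:ℕ)-1 := by push_cast; linarith
  have am := Real.geom_mean_le_arith_mean2_weighted (w₁ := m*(1-t)/q) (w₂ := (m+1)*t/q)
    (by positivity) (by positivity) p1 p2 (by rw [hq]; field_simp; ring)
  have n1 := Real.rpow_nonneg p1 (m*(1-t)/q)
  have n2 := Real.rpow_nonneg p2 ((m+1)*t/q)
  have b : m*(1-t)/q * (2*m-1) + (m+1)*t/q * (2*(m+1:ℕ)-1) ≤ 3*(q-1) := by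
    rw [div_mul_eq_mul_div, div_mul_eq_mul_div, ← add_div, div_le_iff₀ hqp, hq]
    push_cast
    nlinarith [mul_nonneg h0 (sub_nonneg.2 hm'), mul_nonneg (sub_nonneg.2 hm') (by linarith : (0:ℝ) ≤ m), sq_nonneg t]
  have := Real.rpow_le_rpow (mul_nonneg n1 n2) (am.trans b) hqp.le
  rw [Real.mul_rpow n1 n2, ← Real.rpow_mul p1, ← Real.rpow_mul p2, div_mul_cancel₀ _ hqp.ne',
    div_mul_cancel₀ _ hqp.ne'] at this
  rw [← Real.rpow_natCast, ← Real.rpow_natCast, ← Real.rpow_mul p1, ← Real.rpow_mul p2]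
  push_cast at this ⊢
  exact this

end HC
end

/-- The standard Gaussian measure on `ℝ^d` (i.i.d. `N(0,1)` coordinates). -/
noncomputable def stdGaussian (d : ℕ) : Measure (Fin d → ℝ) :=
  Measure.pi fun _ => gaussianReal 0 1

/-- If `f : ℝ^d → ℝ^k` is a polynomial of degree at most `D`, `Y` is a
standard Gaussian vector on `ℝ^d`, and `q ∈ [2, ∞)`, then
`E[‖f(Y)‖₂^{2q}] ≤ (3(q-1))^{qD} (E[‖f(Y)‖₂²])^q`. -/
theorem stmt_1 (d k D : ℕ)
    (f : (Fin d → ℝ) → Fin k → ℝ)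
    (P : Fin k → MvPolynomial (Fin d) ℝ)
    (hdeg : ∀ i, (P i).totalDegree ≤ D)
    (hf : ∀ x i, f x i = MvPolynomial.eval x (P i))
    (q : ℝ) (hq : 2 ≤ q) :
    (∫ y, (∑ i, (f y i) ^ 2) ^ q ∂(stdGaussian d)) ≤
      (3 * (q - 1)) ^ (q * (D : ℝ)) *
        (∫ y, ∑ i, (f y i) ^ 2 ∂(stdGaussian d)) ^ q := by
  have hfe : f = fun y i => MvPolynomial.eval y (P i) := by funext y i; exact hf y i
  subst hfe
  unfold _root_.stdGaussian
  have hint : ∀ n : ℕ, Integrable (fun y => (∑ i, MvPolynomial.eval y (P i)^2)^n)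
      (Measure.pi fun _ : Fin d => gaussianReal 0 1) := by
    intro n
    have := HC.integrable_poly ((∑ i, P i^2)^n)
    simpa only [map_pow, map_sum] using this
  have hgh := HC.gauss_hyper P hdeg
  have hF0 : ∀ y, 0 ≤ ∑ i, MvPolynomial.eval y (P i)^2 := fun y => by positivity
  have hi1 := hint 1
  simp only [pow_one] at hi1
  set μ := Measure.pi fun _ : Fin d => gaussianReal 0 1 with hμ
  generalize hF : (fun y => ∑ i, MvPolynomial.eval y (P i)^2) = F at *
  have hF' : ∀ y, ∑ i, MvPolynomial.eval y (P i)^2 = F y := fun y => congrFun hF y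
  simp only [hF'] at *
  set s := ∫ y, F y ∂μ with hs
  have hs0 : 0 ≤ s := integral_nonneg hF0
  have hbase : 0 ≤ 3*(q-1) := by linarith
  rcases hs0.eq_or_lt with hz | hsp
  · have h1 : F =ᵐ[μ] 0 := (integral_eq_zero_iff_of_nonneg hF0 hi1).1 hz.symm
    have h2 : ∫ y, F y ^ q ∂μ = 0 := by
      rw [integral_congr_ae (g := fun _ => (0:ℝ))]
      · simp
      · filter_upwards [h1] with y hy
        rw [hy]; exact Real.zero_rpow (by linarith)
    rw [h2]; positivity
  obtain ⟨m, t, hm, ht0, ht1, rfl⟩ : ∃ (m : ℕ) (t : ℝ), 2 ≤ m ∧ 0 ≤ t ∧ t ≤ 1 ∧ q = m + t :=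
    ⟨⌊q⌋₊, q - ⌊q⌋₊, Nat.le_floor (by exact_mod_cast hq),
      sub_nonneg.2 (Nat.floor_le (by linarith)), by linarith [Nat.lt_floor_add_one q], by ring⟩
  have hm' : (2:ℝ) ≤ m := by exact_mod_cast hm
  have p1 : (0:ℝ) < 2*m-1 := by linarith
  have p2 : (0:ℝ) < 2*(m+1:ℕ)-1 := by push_cast; linarith
  have ht : 0 ≤ 1 - t := by linarith
  have hA := hgh m (by omega)
  have hB := hgh (m+1) (by omega)
  set A : ℝ := ((2*m-1)^D * s)^m with hAd
  set B : ℝ := ((2*(m+1:ℕ)-1)^D * s)^(m+1) with hBd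
  have hAp : 0 < A := by positivity
  have hBp : 0 < B := by positivity
  have key : ∫ y, F y ^ ((m:ℝ)+t) ∂μ ≤ A^(1-t) * B^t := by
    have hpt : ∀ y, F y ^ ((m:ℝ)+t) ≤
        A^(1-t) * B^t * ((1-t)/A * F y^m + t/B * F y^(m+1)) := by
      intro y
      have n1 : 0 ≤ F y^m / A := div_nonneg (pow_nonneg (hF0 y) _) hAp.le
      have n2 : 0 ≤ F y^(m+1) / B := div_nonneg (pow_nonneg (hF0 y) _) hBp.le
      have am := Real.geom_mean_le_arith_mean2_weighted ht ht0 n1 n2 (by ring)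
      have e : F y ^ ((m:ℝ)+t) = A^(1-t) * B^t * ((F y^m/A)^(1-t) * (F y^(m+1)/B)^t) := by
        rw [Real.div_rpow (pow_nonneg (hF0 y) _) hAp.le, Real.div_rpow (pow_nonneg (hF0 y) _) hBp.le]
        have a1 := (Real.rpow_pos_of_pos hAp (1-t)).ne'
        have a2 := (Real.rpow_pos_of_pos hBp t).ne'
        field_simp
        rw [← Real.rpow_natCast, ← Real.rpow_natCast, ← Real.rpow_mul (hF0 y),
          ← Real.rpow_mul (hF0 y), ← Real.rpow_add_of_nonneg (hF0 y) (by positivity) (by positivity)]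
        congr 1; push_cast; ring
      rw [e]
      refine mul_le_mul_of_nonneg_left (am.trans (le_of_eq ?_)) (by positivity)
      ring
    have hii : Integrable (fun y => (1-t)/A * F y^m + t/B * F y^(m+1)) μ :=
      ((hint m).const_mul _).add ((hint (m+1)).const_mul _)
    calc _ ≤ ∫ y, A^(1-t) * B^t * ((1-t)/A * F y^m + t/B * F y^(m+1)) ∂μ :=
          integral_mono_of_nonneg (Filter.Eventually.of_forall fun y => Real.rpow_nonneg (hF0 y) _)
            (hii.const_mul _) (Filter.Eventually.of_forall hpt)
      _ = A^(1-t) * B^t * ((1-t)/A * ∫ y, F y^m ∂μ + t/B * ∫ y, F y^(m+1) ∂μ) := by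
          rw [integral_const_mul, integral_add ((hint m).const_mul _) ((hint (m+1)).const_mul _),
            integral_const_mul, integral_const_mul]
      _ ≤ A^(1-t) * B^t * ((1-t)/A * A + t/B * B) := by gcongr
      _ = _ := by field_simp; ring
  refine key.trans ?_
  have sc := HC.scal m hm t ht0 ht1
  have sc2 := pow_le_pow_left₀ (by positivity) sc D
  have e1 : A^(1-t) * B^t =
      (((2*m-1:ℝ)^m)^(1-t) * ((2*(m+1:ℕ)-1:ℝ)^(m+1))^t)^D * s^((m:ℝ)+t) := by
    have hsA : A = ((2*m-1:ℝ)^m)^D * s^m := by rw [hAd]; ring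
    have hsB : B = ((2*(m+1:ℕ)-1:ℝ)^(m+1))^D * s^(m+1) := by
      rw [hBd, mul_pow, ← pow_mul, ← pow_mul, mul_comm D]
    have hss : s^((m:ℝ)+t) = (s^m)^(1-t) * (s^(m+1))^t := by
      rw [← Real.rpow_natCast, ← Real.rpow_natCast, ← Real.rpow_mul hs0,
          ← Real.rpow_mul hs0, ← Real.rpow_add hsp]
      congr 1; push_cast; ring
    have hX : 0 ≤ (2*m-1:ℝ)^m := by positivity
    have hY : 0 ≤ (2*(m+1:ℕ)-1:ℝ)^(m+1) := by positivity
    rw [hsA, hsB, hss]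
    generalize (2*m-1:ℝ)^m = X at *
    generalize (2*(m+1:ℕ)-1:ℝ)^(m+1) = Y at *
    rw [Real.mul_rpow (by positivity) (by positivity),
      Real.mul_rpow (by positivity) (by positivity), mul_pow, Real.rpow_pow_comm hX,
      Real.rpow_pow_comm hY]
    ring
  rw [e1, Real.rpow_mul hbase, Real.rpow_natCast]
  gcongr
end

section
/- If f : ℝ^d → ℝ^k is a deterministic polynomial of degree at most D with E‖f(Y)‖₂² = 1, where Y is a standard Gaussian random vector on ℝ^d, then for any ρ ∈ [0,1], if (X,Y) is a ρ-correlated pair of standard Gaussian vectors, then E‖f(X) − f(Y)‖₂² ≤ 2(1 − ρ^D). -/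
open MeasureTheory ProbabilityTheory

namespace Stmt3Aux

/-- standard Gaussian on `Fin d → ℝ` -/
noncomputable abbrev G (d : ℕ) : Measure (Fin d → ℝ) := Measure.pi fun _ => gaussianReal 0 1

lemma G_neg (d : ℕ) : MeasurePreserving (fun x : Fin d → ℝ => fun i => - x i) (G d) (G d) := by
  apply measurePreserving_pi (fun _ => gaussianReal 0 1) (fun _ => gaussianReal 0 1)
    (f := fun _ x => -x)
  intro i
  refine ⟨by fun_prop, ?_⟩
  rw [gaussianReal_map_neg]; simp

lemma G_gauss (d : ℕ) : IsGaussian (G d) := by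
  have h := map_pi_eq_stdGaussian (ι := Fin d)
  have h2 : G d = ((G d).map (WithLp.toLp 2)).map (EuclideanSpace.equiv (Fin d) ℝ) := by
    rw [Measure.map_map (by fun_prop) (by fun_prop)]
    exact Measure.map_id.symm
  rw [h2, h]
  infer_instance

lemma G_mean (d : ℕ) : (G d)[id] = 0 := by
  have h := (G_neg d).integral_comp (MeasurableEquiv.neg (Fin d → ℝ)).measurableEmbedding id
  have h2 : ∫ x, id (fun i => - x i) ∂(G d) = - ∫ x, id x ∂(G d) := by
    rw [← integral_neg]; rfl
  rw [h2] at h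
  have h3 : (2:ℝ) • ∫ x, id x ∂(G d) = 0 := by
    rw [two_smul]; nth_rewrite 1 [← h]; simp
  simpa using h3

lemma G_rot (d : ℕ) (θ : ℝ) :
    MeasurePreserving (ContinuousLinearMap.rotation (E := Fin d → ℝ) θ) ((G d).prod (G d))
      ((G d).prod (G d)) := by
  have := G_gauss d
  exact ⟨by fun_prop, IsGaussian.map_rotation_eq_self (G_mean d) θ⟩

lemma int_monomial (d : ℕ) (a : Fin d →₀ ℕ) :
    Integrable (fun x => ∏ i, x i ^ a i) (G d) := by
  apply Integrable.fintype_prod (f := fun i (x : ℝ) => x ^ a i)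
  intro i
  have h := (memLp_id_gaussianReal' (μ := 0) (v := 1) (a i) (by simp))
  by_cases h0 : a i = 0
  · simp [h0]
  · have := h.integrable_norm_pow h0
    rw [← integrable_norm_iff (by fun_prop)]
    simpa using this

lemma int_poly {d : ℕ} (p : MvPolynomial (Fin d) ℝ) :
    Integrable (fun x => MvPolynomial.eval x p) (G d) := by
  simp_rw [MvPolynomial.eval_eq']
  exact integrable_finsetSum _ fun a _ => (int_monomial d a).const_mul _

lemma meas_poly {d : ℕ} (p : MvPolynomial (Fin d) ℝ) :
    Measurable (fun x => MvPolynomial.eval x p) := (MvPolynomial.continuous_eval p).measurable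

lemma memLp_poly {d : ℕ} (p : MvPolynomial (Fin d) ℝ) :
    MemLp (fun x => MvPolynomial.eval x p) 2 (G d) := by
  rw [memLp_two_iff_integrable_sq (meas_poly p).aestronglyMeasurable]
  have := int_poly (p ^ 2)
  simp only [map_pow] at this
  exact this

/-- correlated vector -/
def X {d : ℕ} (ρ s : ℝ) (w : (Fin d → ℝ) × (Fin d → ℝ)) : Fin d → ℝ :=
  fun j => ρ * w.1 j + s * w.2 j

lemma X_meas {d : ℕ} (ρ s : ℝ) : Measurable (X (d := d) ρ s) := by
  unfold X; fun_prop


lemma X_mp {d : ℕ} (θ : ℝ) :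
    MeasurePreserving (X (d := d) (Real.cos θ) (Real.sin θ)) ((G d).prod (G d)) (G d) := by
  have := (measurePreserving_fst (μ := G d) (ν := G d)).comp (G_rot d θ)
  exact this

lemma memLp_X {d : ℕ} (θ : ℝ) (p : MvPolynomial (Fin d) ℝ) :
    MemLp (fun w => MvPolynomial.eval (X (Real.cos θ) (Real.sin θ) w) p) 2
      ((G d).prod (G d)) :=
  (memLp_poly p).comp_measurePreserving (X_mp θ)

lemma memLp_fst {d : ℕ} (p : MvPolynomial (Fin d) ℝ) :
    MemLp (fun w : (Fin d → ℝ) × (Fin d → ℝ) => MvPolynomial.eval w.1 p) 2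
      ((G d).prod (G d)) :=
  (memLp_poly p).comp_measurePreserving (measurePreserving_fst (μ := G d) (ν := G d))

/-- L2 inner product -/
noncomputable def A {d : ℕ} (p q : MvPolynomial (Fin d) ℝ) : ℝ :=
  ∫ y, MvPolynomial.eval y p * MvPolynomial.eval y q ∂(G d)

/-- noise stability form -/
noncomputable def B {d : ℕ} (θ : ℝ) (p q : MvPolynomial (Fin d) ℝ) : ℝ :=
  ∫ w, MvPolynomial.eval (X (Real.cos θ) (Real.sin θ) w) p * MvPolynomial.eval w.1 q
    ∂((G d).prod (G d))

lemma A_add_left {d : ℕ} (p p' q : MvPolynomial (Fin d) ℝ) : A (p + p') q = A p q + A p' q := by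
  unfold A
  have := integral_add ((memLp_poly p).integrable_mul (memLp_poly q))
    ((memLp_poly p').integrable_mul (memLp_poly q))
  simp only [Pi.mul_apply] at this
  rw [← this]
  simp [add_mul]

lemma A_comm {d : ℕ} (p q : MvPolynomial (Fin d) ℝ) : A p q = A q p := by
  simp [A, mul_comm]

lemma B_add_left {d : ℕ} (θ : ℝ) (p p' q : MvPolynomial (Fin d) ℝ) :
    B θ (p + p') q = B θ p q + B θ p' q := by
  unfold B
  have := integral_add ((memLp_X θ p).integrable_mul (memLp_fst q))
    ((memLp_X θ p').integrable_mul (memLp_fst q))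
  simp only [Pi.mul_apply] at this
  rw [← this]
  simp [add_mul]

lemma B_neg {d : ℕ} (θ : ℝ) (p q : MvPolynomial (Fin d) ℝ) : B (-θ) p q = B θ p q := by
  have h := (MeasurePreserving.id (G d)).prod (G_neg d)
  have h2 := h.integral_comp ((MeasurableEquiv.refl _).prodCongr
    (MeasurableEquiv.neg (Fin d → ℝ))).measurableEmbedding
    (fun w => MvPolynomial.eval (X (Real.cos θ) (Real.sin θ) w) p * MvPolynomial.eval w.1 q)
  unfold B
  rw [← h2]
  congr 1
  ext w
  congr 2
  congr 1
  ext j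
  simp [X]

lemma B_symm {d : ℕ} (θ : ℝ) (p q : MvPolynomial (Fin d) ℝ) : B θ p q = B θ q p := by
  rw [← B_neg θ q p]
  unfold B
  conv_rhs => rw [← (G_rot d θ).map_eq]
  rw [integral_map (by fun_prop) (by
    apply Measurable.aestronglyMeasurable
    exact ((meas_poly q).comp (X_meas _ _)).mul ((meas_poly p).comp measurable_fst))]
  congr 1
  ext w
  rw [mul_comm]
  congr 1
  congr 1
  congr 1
  ext j
  simp [X, ContinuousLinearMap.rotation_apply]
  linear_combination (- w.1 j) * Real.sin_sq_add_cos_sq θ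

/-- polynomials of degree less than n -/
noncomputable abbrev V (d n : ℕ) : Submodule ℝ (MvPolynomial (Fin d) ℝ) :=
  MvPolynomial.restrictSupport ℝ {m | m.degree < n}

instance V_fin (d n : ℕ) : FiniteDimensional ℝ (V d n) := by
  have : Finite ({m : Fin d →₀ ℕ | m.degree < n}) := by
    have : {m : Fin d →₀ ℕ | m.degree < n} ⊆ Set.Iic (Finsupp.equivFunOnFinite.symm fun _ => n) := by
      intro m hm i
      have := Finsupp.le_degree i m
      simp at hm ⊢
      omega
    exact (Set.finite_Iic _).subset this
  exact Module.Finite.of_basis (MvPolynomial.basisRestrictSupport ℝ _)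

lemma V_mul {d m n k : ℕ} {p q : MvPolynomial (Fin d) ℝ} (hp : p ∈ V d m) (hq : q ∈ V d n)
    (hk : m + n ≤ k + 1) : p * q ∈ V d k := by
  classical
  intro a ha
  obtain ⟨b, hb, c, hc, rfl⟩ := Finset.mem_add.1 (MvPolynomial.support_mul p q ha)
  have h1 : b.degree < m := hp hb
  have h2 : c.degree < n := hq hc
  change (b + c).degree < k
  rw [map_add]
  omega

lemma V_mono {d m n : ℕ} (h : m ≤ n) : V d m ≤ V d n :=
  MvPolynomial.restrictSupport_mono _ fun a (ha : a.degree < m) => lt_of_lt_of_le ha h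

lemma V_Xpow {d : ℕ} (j : Fin d) {m n : ℕ} (h : m < n) :
    (MvPolynomial.X j ^ m : MvPolynomial (Fin d) ℝ) ∈ V d n := by
  rw [MvPolynomial.X_pow_eq_monomial, MvPolynomial.monomial_mem_restrictSupport]
  left
  simpa using h

lemma int_pow (m : ℕ) : Integrable (fun x : ℝ => x ^ m) (gaussianReal 0 1) := by
  have h := (memLp_id_gaussianReal' (μ := 0) (v := 1) m (by simp))
  by_cases h0 : m = 0
  · simp [h0]
  · have := h.integrable_norm_pow h0
    rw [← integrable_norm_iff (by fun_prop)]
    simpa using this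

lemma one_dim {d : ℕ} (ρ s : ℝ) (j : Fin d) (m : ℕ) : ∃ R : MvPolynomial (Fin d) ℝ,
    R - ρ ^ m • MvPolynomial.X j ^ m ∈ V d m ∧
    ∀ y, MvPolynomial.eval y R = ∫ z, (ρ * y j + s * z) ^ m ∂(gaussianReal 0 1) := by
  refine ⟨∑ i ∈ Finset.range (m + 1),
    (ρ ^ i * s ^ (m - i) * m.choose i * ∫ z, z ^ (m - i) ∂(gaussianReal 0 1)) •
      MvPolynomial.X j ^ i, ?_, ?_⟩
  · rw [Finset.sum_range_succ]
    simp only [Nat.sub_self, pow_zero, mul_one, Nat.choose_self, Nat.cast_one, integral_const,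
      probReal_univ, smul_eq_mul, add_sub_cancel_right]
    exact Submodule.sum_mem _ fun i hi => Submodule.smul_mem _ _ (V_Xpow j (Finset.mem_range.1 hi))
  · intro y
    simp_rw [add_pow]
    rw [integral_finsetSum]
    · rw [map_sum]
      refine Finset.sum_congr rfl fun i _ => ?_
      simp only [MvPolynomial.smul_eval, map_pow, MvPolynomial.eval_X]
      rw [integral_mul_const]
      simp_rw [mul_pow, ← mul_assoc]
      rw [integral_const_mul]
      ring
    · intro i _
      simp_rw [mul_pow]
      exact (((int_pow _).const_mul _).const_mul _).mul_const _

lemma prod_low {d : ℕ} (ρ : ℝ) (a : Fin d → ℕ) (R : Fin d → MvPolynomial (Fin d) ℝ)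
    (hR : ∀ j, R j - ρ ^ (a j) • MvPolynomial.X j ^ (a j) ∈ V d (a j)) (S : Finset (Fin d)) :
    (∏ j ∈ S, MvPolynomial.X j ^ (a j)) ∈ V d (∑ j ∈ S, a j + 1) ∧
    ∏ j ∈ S, R j - ρ ^ (∑ j ∈ S, a j) • ∏ j ∈ S, MvPolynomial.X j ^ (a j)
      ∈ V d (∑ j ∈ S, a j) := by
  classical
  induction S using Finset.induction_on with
  | empty =>
    simp only [Finset.prod_empty, Finset.sum_empty, pow_zero, one_smul, sub_self,
      Submodule.zero_mem, and_true]
    have := MvPolynomial.monomial_mem_restrictSupport (R := ℝ) (σ := Fin d)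
      (s := {m | m.degree < 0 + 1}) (m := 0) (r := 1)
    exact this.2 (Or.inl (by simp))
  | insert j S hj ih =>
    obtain ⟨h1, h2⟩ := ih
    rw [Finset.prod_insert hj, Finset.prod_insert hj, Finset.sum_insert hj]
    have hX := V_Xpow j (Nat.lt_succ_self (a j))
    refine ⟨V_mul hX h1 (by omega), ?_⟩
    have h3 : ∏ j ∈ S, R j ∈ V d (∑ j ∈ S, a j + 1) := by
      have := Submodule.add_mem _ (V_mono (Nat.le_succ _) h2)
        (Submodule.smul_mem _ (ρ ^ (∑ j ∈ S, a j)) h1)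
      rwa [sub_add_cancel] at this
    have h4 := Submodule.add_mem _ (V_mul (hR j) h3 (k := a j + ∑ j ∈ S, a j) (by omega))
      (Submodule.smul_mem _ (ρ ^ a j) (V_mul hX h2 (k := a j + ∑ j ∈ S, a j) (by omega)))
    convert h4 using 1
    simp only [MvPolynomial.smul_eq_C_mul, pow_add, map_mul]
    ring

lemma int_shift {d : ℕ} (ρ s : ℝ) (p : MvPolynomial (Fin d) ℝ) (y : Fin d → ℝ) :
    Integrable (fun z => MvPolynomial.eval (X ρ s (y, z)) p) (G d) := by
  have := int_poly (MvPolynomial.bind₁ (fun j => MvPolynomial.C (ρ * y j) +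
    MvPolynomial.C s * MvPolynomial.X j) p)
  convert this using 2 with z
  rw [← MvPolynomial.coe_aeval_eq_eval, ← MvPolynomial.coe_aeval_eq_eval]
  simp only [RingHom.coe_coe, MvPolynomial.aeval_bind₁]
  congr 2
  ext j
  simp [X]

lemma T_low {d : ℕ} (ρ s : ℝ) (n : ℕ) (p : MvPolynomial (Fin d) ℝ) (hp : p ∈ V d (n + 1)) :
    ∃ r ∈ V d n, ∀ y, ∫ z, MvPolynomial.eval (X ρ s (y, z)) p ∂(G d) =
      MvPolynomial.eval y (ρ ^ n • p + r) := by
  rw [V, MvPolynomial.restrictSupport_eq_span] at hp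
  induction hp using Submodule.span_induction with
  | mem p hp =>
    obtain ⟨a, ha, rfl⟩ := hp
    have ha : a.degree < n + 1 := ha
    choose R hR1 hR2 using fun j => one_dim ρ s j (a j)
    obtain ⟨-, h⟩ := prod_low ρ a R hR1 Finset.univ
    rw [← Finsupp.degree_eq_sum] at h
    have hm : MvPolynomial.monomial a (1:ℝ) = ∏ j, MvPolynomial.X j ^ (a j) := by
      rw [MvPolynomial.monomial_eq, Finsupp.prod_fintype _ _ (by simp)]; simp
    rw [← hm] at h
    refine ⟨∏ j, R j - ρ ^ n • MvPolynomial.monomial a (1:ℝ), ?_, ?_⟩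
    · rcases Nat.lt_succ_iff_lt_or_eq.1 ha with hlt | heq
      · have hmem : MvPolynomial.monomial a (1:ℝ) ∈ V d n :=
          (MvPolynomial.monomial_mem_restrictSupport _).2 (Or.inl hlt)
        have := Submodule.add_mem _ (V_mono hlt.le h)
          (Submodule.smul_mem _ (ρ ^ a.degree - ρ ^ n) hmem)
        convert this using 1
        rw [sub_smul]; abel
      · rw [← heq]; exact h
    · intro y
      rw [add_sub_cancel, map_prod]
      simp_rw [hR2]
      rw [← integral_fintype_prod_eq_prod (fun j z => (ρ * y j + s * z) ^ a j), hm]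
      simp [X]
  | zero => exact ⟨0, Submodule.zero_mem _, by simp⟩
  | add p q _ _ ihp ihq =>
    obtain ⟨r, hr, h⟩ := ihp
    obtain ⟨r', hr', h'⟩ := ihq
    refine ⟨r + r', Submodule.add_mem _ hr hr', fun y => ?_⟩
    simp only [map_add]
    rw [integral_add (int_shift ρ s p y) (int_shift ρ s q y), h, h']
    simp only [map_add, smul_add]
    ring
  | smul c p _ ih =>
    obtain ⟨r, hr, h⟩ := ih
    refine ⟨c • r, Submodule.smul_mem _ _ hr, fun y => ?_⟩
    simp only [MvPolynomial.smul_eval]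
    rw [integral_const_mul, h]
    simp only [map_add, MvPolynomial.smul_eval]
    ring

lemma B_eq {d : ℕ} (θ : ℝ) (p t q : MvPolynomial (Fin d) ℝ)
    (h : ∀ y, ∫ z, MvPolynomial.eval (X (Real.cos θ) (Real.sin θ) (y, z)) p ∂(G d) =
      MvPolynomial.eval y t) : B θ p q = A t q := by
  unfold B A
  have := integral_prod _ ((memLp_X θ p).integrable_mul (memLp_fst q))
  simp only [Pi.mul_apply] at this
  rw [this]
  simp only [integral_mul_const, h]

/-- evaluation to L2 -/
noncomputable def ev (d : ℕ) : MvPolynomial (Fin d) ℝ →ₗ[ℝ] Lp ℝ 2 (G d) where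
  toFun p := (memLp_poly p).toLp
  map_add' p q := by
    rw [← MemLp.toLp_add]; congr; ext; simp
  map_smul' c p := by
    rw [RingHom.id_apply, ← MemLp.toLp_const_smul]; congr; ext; simp [MvPolynomial.smul_eval]

lemma inner_ev {d : ℕ} (p q : MvPolynomial (Fin d) ℝ) : inner ℝ (ev d p) (ev d q) = A p q := by
  rw [L2.inner_def]
  unfold A
  apply integral_congr_ae
  filter_upwards [(memLp_poly p).coeFn_toLp, (memLp_poly q).coeFn_toLp] with x h1 h2
  simp only [ev, LinearMap.coe_mk, AddHom.coe_mk]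
  rw [h1, h2]
  simp [mul_comm]

lemma exists_proj {d : ℕ} (n : ℕ) (p : MvPolynomial (Fin d) ℝ) :
    ∃ g ∈ V d n, ∀ q ∈ V d n, A (p - g) q = 0 := by
  let W := (V d n).map (ev d)
  have : FiniteDimensional ℝ W := inferInstance
  obtain ⟨g, hg, hge⟩ := (W.orthogonalProjectionOnto (ev d p)).2
  refine ⟨g, hg, fun q hq => ?_⟩
  rw [← inner_ev, map_sub, hge]
  exact W.starProjection_inner_eq_zero _ _ ⟨q, hq, rfl⟩


lemma A_smul_left {d : ℕ} (c : ℝ) (p q : MvPolynomial (Fin d) ℝ) : A (c • p) q = c * A p q := by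
  unfold A
  rw [← integral_const_mul]
  simp [MvPolynomial.smul_eval, mul_assoc]

lemma A_nonneg {d : ℕ} (p : MvPolynomial (Fin d) ℝ) : 0 ≤ A p p :=
  integral_nonneg fun _ => mul_self_nonneg _

lemma key {d : ℕ} (θ : ℝ) (h0 : 0 ≤ Real.cos θ) (n N : ℕ) (hn : n ≤ N + 1)
    (p : MvPolynomial (Fin d) ℝ) (hp : p ∈ V d n) :
    Real.cos θ ^ N * A p p ≤ B θ p p := by
  induction n generalizing p with
  | zero =>
    have : p = 0 := by
      rw [← MvPolynomial.support_eq_empty, Finset.eq_empty_iff_forall_notMem]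
      intro a ha
      exact Nat.not_lt_zero _ (hp ha)
    subst this
    simp [A, B]
  | succ n ih =>
    obtain ⟨g, hg, hort⟩ := exists_proj n p
    set h := p - g with hh
    have hpe : p = g + h := by rw [hh]; abel
    have hhV : h ∈ V d (n + 1) := Submodule.sub_mem _ hp (V_mono (Nat.le_succ n) hg)
    obtain ⟨r, hr, hr'⟩ := T_low (Real.cos θ) (Real.sin θ) n h hhV
    obtain ⟨u, hu, hu'⟩ := T_low (Real.cos θ) (Real.sin θ) n g (V_mono (Nat.le_succ n) hg)
    have e1 : B θ g h = 0 := by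
      rw [B_eq θ _ _ _ hu', A_comm]
      exact hort _ (Submodule.add_mem _ (Submodule.smul_mem _ _ hg) hu)
    have e2 : B θ h h = Real.cos θ ^ n * A h h := by
      rw [B_eq θ _ _ _ hr', A_add_left, A_smul_left, A_comm r h, hort _ hr, add_zero]
    have e3 : A h g = 0 := hort _ hg
    have e4 : A p p = A g g + A h h := by
      rw [hpe, A_add_left, A_comm g, A_comm h (g + h), A_add_left, A_add_left, A_comm g h, e3]
      ring
    have e5 : B θ p p = B θ g g + B θ h h := by
      rw [hpe, B_add_left, B_symm θ g, B_symm θ h (g + h), B_add_left, B_add_left,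
        B_symm θ h g, e1]
      ring
    have i1 := ih (by omega) g hg
    have i2 : Real.cos θ ^ N ≤ Real.cos θ ^ n :=
      pow_le_pow_of_le_one h0 (Real.cos_le_one θ) (by omega)
    rw [e4, e5, e2, mul_add]
    exact add_le_add i1 (mul_le_mul_of_nonneg_right i2 (A_nonneg h))

lemma single {d : ℕ} (θ : ℝ) (h0 : 0 ≤ Real.cos θ) (N : ℕ)
    (p : MvPolynomial (Fin d) ℝ) (hp : p.totalDegree ≤ N) :
    Integrable (fun w => (MvPolynomial.eval (X (Real.cos θ) (Real.sin θ) w) p -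
      MvPolynomial.eval w.1 p) ^ 2) ((G d).prod (G d)) ∧
    ∫ w, (MvPolynomial.eval (X (Real.cos θ) (Real.sin θ) w) p -
      MvPolynomial.eval w.1 p) ^ 2 ∂((G d).prod (G d)) ≤ 2 * (1 - Real.cos θ ^ N) * A p p := by
  have hV : p ∈ V d (N + 1) := by
    intro a ha
    have := MvPolynomial.le_totalDegree ha
    change a.degree < N + 1
    rw [Finsupp.degree_apply]
    exact Nat.lt_succ_of_le (this.trans hp)
  have hk := key θ h0 (N + 1) N le_rfl p hV
  have m1 := memLp_X θ p
  have m2 := memLp_fst p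
  refine ⟨(m1.sub m2).integrable_sq, ?_⟩
  have a1 : ∫ w, MvPolynomial.eval (X (Real.cos θ) (Real.sin θ) w) p ^ 2 ∂((G d).prod (G d))
      = A p p := by
    have := integral_map (μ := (G d).prod (G d)) (X_mp θ).aemeasurable
      (f := fun x => MvPolynomial.eval x p ^ 2)
      (((meas_poly p).pow_const 2).aestronglyMeasurable)
    rw [← this, (X_mp θ).map_eq]
    simp [A, sq]
  have a2 : ∫ w, MvPolynomial.eval w.1 p ^ 2 ∂((G d).prod (G d)) = A p p := by
    have hm := measurePreserving_fst (μ := G d) (ν := G d)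
    have := integral_map (μ := (G d).prod (G d)) hm.aemeasurable
      (f := fun x => MvPolynomial.eval x p ^ 2)
      (((meas_poly p).pow_const 2).aestronglyMeasurable)
    rw [← this, hm.map_eq]
    simp [A, sq]
  have a3 : ∫ w, (MvPolynomial.eval (X (Real.cos θ) (Real.sin θ) w) p -
      MvPolynomial.eval w.1 p) ^ 2 ∂((G d).prod (G d)) = A p p + A p p - 2 * B θ p p := by
    have i3 : Integrable (fun w : (Fin d → ℝ) × (Fin d → ℝ) =>
      MvPolynomial.eval (X (Real.cos θ) (Real.sin θ) w) p *
      MvPolynomial.eval w.1 p) ((G d).prod (G d)) := m1.integrable_mul m2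
    nth_rewrite 1 [← a1]
    rw [← a2, B, ← integral_const_mul, ← integral_add m1.integrable_sq m2.integrable_sq,
      ← integral_sub (by exact m1.integrable_sq.add m2.integrable_sq) (i3.const_mul 2)]
    congr 1
    ext w
    ring
  rw [a3]
  linarith

end Stmt3Aux

/-- If `f : ℝ^d → ℝ^k` is a polynomial of degree at most `D` with
`E ‖f(Y)‖₂² = 1` for `Y` standard Gaussian on `ℝ^d`, then for any `ρ ∈ [0,1]`, if `(X, Y)` is
a `ρ`-correlated pair of standard Gaussian vectors (realized as `X = ρ Y + √(1-ρ²) Y'` with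
`Y'` an independent copy of `Y`), then `E ‖f(X) - f(Y)‖₂² ≤ 2 (1 - ρ^D)`. -/
theorem stmt_3 (d k D : ℕ)
    (f : (Fin d → ℝ) → Fin k → ℝ)
    (P : Fin k → MvPolynomial (Fin d) ℝ)
    (hdeg : ∀ i, (P i).totalDegree ≤ D)
    (hf : ∀ x i, f x i = MvPolynomial.eval x (P i))
    (hnorm : ∫ y, ∑ i, (f y i) ^ 2 ∂(stdGaussian d) = 1)
    (ρ : ℝ) (hρ0 : 0 ≤ ρ) (hρ1 : ρ ≤ 1) :
    (∫ yz : (Fin d → ℝ) × (Fin d → ℝ),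
        ∑ i, (f (fun j => ρ * yz.1 j + Real.sqrt (1 - ρ ^ 2) * yz.2 j) i - f yz.1 i) ^ 2
        ∂((stdGaussian d).prod (stdGaussian d))) ≤
      2 * (1 - ρ ^ D) := by
  have hc : Real.cos (Real.arccos ρ) = ρ := Real.cos_arccos (by linarith) hρ1
  have hs : Real.sin (Real.arccos ρ) = Real.sqrt (1 - ρ ^ 2) := Real.sin_arccos ρ
  have hS := fun i => Stmt3Aux.single (Real.arccos ρ) (by rw [hc]; exact hρ0) D (P i) (hdeg i)
  rw [hc, hs] at hS
  have hG : _root_.stdGaussian d = Stmt3Aux.G d := rfl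
  rw [hG] at hnorm ⊢
  have hA : ∑ i, Stmt3Aux.A (P i) (P i) = 1 := by
    rw [← hnorm]
    simp_rw [hf]
    rw [integral_finsetSum _ fun i _ => (Stmt3Aux.memLp_poly (P i)).integrable_sq]
    simp only [Stmt3Aux.A, sq]
  simp_rw [hf]
  have hI := integral_finsetSum (Finset.univ : Finset (Fin k)) fun i _ => (hS i).1
  refine (le_of_eq hI).trans ?_
  refine (Finset.sum_le_sum fun i _ => (hS i).2).trans ?_
  rw [← Finset.mul_sum, hA, mul_one]
end
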